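/- Let E be a Gysin functor on a finitary lextensive category C, and let α ∈ C_E(W, Z) = E(Z × W). Then: (i) for f : Y → W, α ∘ Rf = (id_Z × f)^*(α) in E(Z × Y); (ii) for g : Z → U, Rg ∘ α = (g × id_W)_!(α) in E(U × W); (iii) for f' : W → Y, α ∘ If' = (id_Z × f')_!(α) in E(Z × Y); (iv) for g' : U → Z, Ig' ∘ α = (g' × id_W)^*(α) in E(U × W). -/

import Mathlib

open CategoryTheory CategoryTheory.Limits

universe v u

/-- A Gysin functor on a finitary lextensive category `C`. -/
structure GysinFunctor (C : Type u) [Category.{v} C] [HasFiniteLimits C]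
    [HasFiniteCoproducts C] [FinitaryExtensive C] where
  /-- The underlying rings. -/
  E : C → Type v
  commRing : ∀ X : C, CommRing (E X)
  /-- Contravariant functoriality (pullback), by ring maps. -/
  pull : ∀ {X Y : C}, (X ⟶ Y) → (E Y →+* E X)
  pull_id : ∀ X : C, pull (𝟙 X) = RingHom.id (E X)
  pull_comp : ∀ {X Y Z : C} (f : X ⟶ Y) (g : Y ⟶ Z),
    pull (f ≫ g) = (pull f).comp (pull g)
  /-- Covariant functoriality (pushforward/Gysin maps), by additive maps. -/
  push : ∀ {X Y : C}, (X ⟶ Y) → (E X →+ E Y)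
  push_id : ∀ X : C, push (𝟙 X) = AddMonoidHom.id (E X)
  push_comp : ∀ {X Y Z : C} (f : X ⟶ Y) (g : Y ⟶ Z),
    push (f ≫ g) = (push g).comp (push f)
  /-- Zero axiom: `E ∅ = 0`. -/
  zero : Subsingleton (E (⊥_ C))
  /-- Behavior on sums. -/
  coprod_bij : ∀ X Y : C, Function.Bijective
    (fun a : E (X ⨿ Y) => (pull coprod.inl a, pull coprod.inr a))
  /-- Push-product axiom. -/
  push_product : ∀ {X X' Y Y' : C} (f : X ⟶ X') (g : Y ⟶ Y') (a : E X) (b : E Y),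
    push (prod.map f g) (pull prod.fst a * pull prod.snd b)
      = pull prod.fst (push f a) * pull prod.snd (push g b)
  /-- Push-pull axiom. -/
  push_pull : ∀ {A B C' D' : C} (f : A ⟶ B) (p : A ⟶ C') (q : B ⟶ D') (g : C' ⟶ D'),
    IsPullback f p q g → ∀ a : E C', push f (pull p a) = pull q (push g a)

namespace GysinFunctor

attribute [instance] GysinFunctor.commRing

variable {C : Type u} [Category.{v} C] [HasFiniteLimits C]
  [HasFiniteCoproducts C] [FinitaryExtensive C] (G : GysinFunctor C)

/-- Hom-groups of the category of correspondences: `C_E(A, B) = E(B × A)`. -/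
noncomputable def Hom (A B : C) : Type v := G.E (B ⨯ A)

noncomputable instance (A B : C) : AddCommGroup (G.Hom A B) :=
  inferInstanceAs (AddCommGroup (G.E (B ⨯ A)))

/-- Composition in the category of correspondences. -/
noncomputable def comp {A B Cc : C} (β : G.Hom B Cc) (α : G.Hom A B) : G.Hom A Cc :=
  G.push (prod.map prod.fst (𝟙 A) : (Cc ⨯ B) ⨯ A ⟶ Cc ⨯ A)
    (G.pull (prod.fst : (Cc ⨯ B) ⨯ A ⟶ Cc ⨯ B) β *
      G.pull (prod.map prod.snd (𝟙 A) : (Cc ⨯ B) ⨯ A ⟶ B ⨯ A) α)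

/-- The identity morphism `i_A = Δ_!(1)` in the category of correspondences. -/
noncomputable def ident (A : C) : G.Hom A A := G.push (diag A) 1

/-- `Rf`, the forward map associated to `f : A ⟶ B`. -/
noncomputable def Rmor {A B : C} (f : A ⟶ B) : G.Hom A B :=
  G.push (prod.lift f (𝟙 A)) 1

/-- `If`, the transfer map associated to `f : A ⟶ B`. -/
noncomputable def Imor {A B : C} (f : A ⟶ B) : G.Hom B A :=
  G.push (prod.lift (𝟙 A) f) 1

/-- `Da`, the diagonal endomorphism associated to `a ∈ E(A)`. -/
noncomputable def Dmor {A : C} (a : G.E A) : G.Hom A A := G.push (diag A) a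

/-- The duality anti-automorphism on hom-groups. -/
noncomputable def star {A B : C} (α : G.Hom A B) : G.Hom B A :=
  G.pull (prod.braiding A B).hom α

end GysinFunctor

namespace GysinFunctor

section PullbackSquares

variable {C : Type u} [Category.{v} C] [HasFiniteLimits C]

lemma isPullback_graph {A B : C} (f : A ⟶ B) :
    IsPullback f (prod.lift f (𝟙 A)) (diag B) (prod.map (𝟙 B) f) := by
  refine ⟨⟨by ext <;> simp [prod.lift_fst, prod.lift_snd]⟩,
    ⟨PullbackCone.IsLimit.mk _ (fun s => s.snd ≫ prod.snd) ?_ ?_ ?_⟩⟩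
  · intro s
    have h₂ := s.condition =≫ prod.snd
    simpa [prod.lift_snd] using h₂.symm
  · intro s
    have h₁ := s.condition =≫ prod.fst
    have h₂ := s.condition =≫ prod.snd
    simp only [Category.assoc, diag, prod.lift_fst, prod.lift_snd, prod.map_fst, prod.map_snd,
      Category.comp_id] at h₁ h₂
    ext
    · simp [prod.lift_fst, ← h₁, ← h₂]
    · simp [prod.lift_snd]
  · intro s m _ h₂
    simp [prod.lift_snd, ← h₂]

lemma isPullback_map_id {X Y : C} (A : C) (h : X ⟶ Y) :
    IsPullback (prod.map h (𝟙 A)) prod.fst prod.fst h := by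
  refine ⟨⟨by simp⟩, ⟨PullbackCone.IsLimit.mk _
    (fun s => prod.lift s.snd (s.fst ≫ prod.snd)) ?_ ?_ ?_⟩⟩
  · intro s
    ext
    · simp [prod.lift_fst, ← s.condition]
    · simp [prod.lift_snd]
  · intro s
    simp [prod.lift_fst]
  · intro s m h₁ h₂
    ext
    · simp [prod.lift_fst, ← h₂]
    · simp [prod.lift_snd, ← h₁]

lemma isPullback_lift_assoc {X A B : C} (Z : C) (h : X ⟶ B ⨯ A) :
    IsPullback
      (prod.lift (prod.lift prod.fst (prod.snd ≫ h ≫ prod.fst)) (prod.snd ≫ h ≫ prod.snd) :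
        Z ⨯ X ⟶ (Z ⨯ B) ⨯ A)
      prod.snd (prod.map prod.snd (𝟙 A)) h := by
  refine ⟨⟨by ext <;> simp [prod.lift_fst, prod.lift_snd]⟩, ⟨PullbackCone.IsLimit.mk _
    (fun s => prod.lift (s.fst ≫ prod.fst ≫ prod.fst) s.snd) ?_ ?_ ?_⟩⟩
  · intro s
    have h₁ := s.condition =≫ prod.fst
    have h₂ := s.condition =≫ prod.snd
    simp only [Category.assoc, prod.map_fst, prod.map_snd, Category.comp_id] at h₁ h₂
    ext <;> simp [prod.lift_fst, prod.lift_snd, prod.lift_snd_assoc, h₁, h₂]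
  · intro s
    simp [prod.lift_snd]
  · intro s m h₁ h₂
    ext
    · simp [prod.lift_fst, prod.lift_fst_assoc, ← h₁]
    · simp [prod.lift_snd, ← h₂]

end PullbackSquares

variable {C : Type u} [Category.{v} C] [HasFiniteLimits C]
  [HasFiniteCoproducts C] [FinitaryExtensive C] (G : GysinFunctor C)

lemma pull_pull {X Y Z : C} (f : X ⟶ Y) (g : Y ⟶ Z) (a : G.E Z) :
    G.pull f (G.pull g a) = G.pull (f ≫ g) a := by
  rw [G.pull_comp, RingHom.comp_apply]

lemma push_push {X Y Z : C} (f : X ⟶ Y) (g : Y ⟶ Z) (a : G.E X) :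
    G.push g (G.push f a) = G.push (f ≫ g) a := by
  rw [G.push_comp, AddMonoidHom.comp_apply]

/-- Frobenius reciprocity. -/
lemma push_pull_mul {A B : C} (f : A ⟶ B) (b : G.E B) (a : G.E A) :
    G.push f (G.pull f b * a) = b * G.push f a := by
  have h := G.push_pull _ _ _ _ (isPullback_graph f) (G.pull prod.fst b * G.pull prod.snd a)
  rw [G.push_product, G.push_id] at h
  simpa [prod.lift_fst, prod.lift_snd, pull_pull, G.pull_id] using h

lemma mul_push_one {A B : C} (f : A ⟶ B) (b : G.E B) :
    b * G.push f 1 = G.push f (G.pull f b) := by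
  rw [← push_pull_mul, mul_one]

/-- Composition on the right with the pushforward of `1` along `h : X ⟶ B ⨯ A`. -/
lemma comp_push_one {X A B Z : C} (β : G.Hom B Z) (h : X ⟶ B ⨯ A) :
    G.comp β (G.push h 1 : G.E (B ⨯ A)) =
      G.push (prod.map (𝟙 Z) (h ≫ prod.snd))
        (G.pull (prod.map (𝟙 Z) (h ≫ prod.fst)) β) := by
  have hp := G.push_pull _ _ _ _ (isPullback_lift_assoc Z h) 1
  rw [map_one] at hp
  unfold comp
  erw [← hp, mul_push_one, pull_pull, push_push]
  congr 2
  · ext <;> simp [prod.lift_fst, prod.lift_snd]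
  · congr 1
    ext <;> simp [prod.lift_fst, prod.lift_snd]

/-- Composition on the left with the pushforward of `1` along `h : X ⟶ Z ⨯ B`. -/
lemma push_one_comp {X A B Z : C} (h : X ⟶ Z ⨯ B) (α : G.Hom A B) :
    G.comp (G.push h 1 : G.E (Z ⨯ B)) α =
      G.push (prod.map (h ≫ prod.fst) (𝟙 A))
        (G.pull (prod.map (h ≫ prod.snd) (𝟙 A)) α) := by
  have hp := G.push_pull _ _ _ _ (isPullback_map_id A h) 1
  rw [map_one] at hp
  unfold comp
  erw [← hp, mul_comm, mul_push_one, pull_pull, push_push]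
  congr 2
  · ext <;> simp
  · congr 1
    ext <;> simp

end GysinFunctor

open GysinFunctor in
/-- Composing a correspondence `α ∈ C_E(W, Z) = E(Z × W)` with the maps `Rf`, `Rg`, `If'`, `Ig'`. -/
theorem gysinFunctor_comp_R_I
    {C : Type u} [Category.{v} C] [HasFiniteLimits C]
    [HasFiniteCoproducts C] [FinitaryExtensive C] (G : GysinFunctor C)
    {W Z : C} (α : G.Hom W Z) :
    -- (i)
    (∀ {Y : C} (f : Y ⟶ W), G.comp α (G.Rmor f) = G.pull (prod.map (𝟙 Z) f) α) ∧
    -- (ii)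
    (∀ {U : C} (g : Z ⟶ U), G.comp (G.Rmor g) α = G.push (prod.map g (𝟙 W)) α) ∧
    -- (iii)
    (∀ {Y : C} (f' : W ⟶ Y), G.comp α (G.Imor f') = G.push (prod.map (𝟙 Z) f') α) ∧
    -- (iv)
    (∀ {U : C} (g' : U ⟶ Z), G.comp (G.Imor g') α = G.pull (prod.map g' (𝟙 W)) α) := by
  refine ⟨fun f => ?_, fun g => ?_, fun f' => ?_, fun g' => ?_⟩
  · refine (G.comp_push_one α _).trans ?_
    simp [prod.lift_fst, prod.lift_snd, G.push_id]
    rfl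
  · refine (G.push_one_comp _ α).trans ?_
    simp [prod.lift_fst, prod.lift_snd, G.pull_id]
    rfl
  · refine (G.comp_push_one α _).trans ?_
    simp [prod.lift_fst, prod.lift_snd, G.pull_id]
    rfl
  · refine (G.push_one_comp _ α).trans ?_
    simp [prod.lift_fst, prod.lift_snd, G.push_id]
    rfl
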